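/- (Lemma 5.) Let P, Q be real polynomials, α ∈ (0,1], M₁, M, C₀ > 0. Assume: u_ε, v_ε : ℝ² × [0,∞) → ℝ are continuous, 2π-periodic in each space variable, with |u_ε|, |v_ε| ≤ M₁ for all ε ∈ (0,1); ρ_ε : ℝ² × [0,∞) → ℝ is C¹ in the space variables, 2π-periodic in each space variable, with |ρ_ε| ≤ M/ε^{2α} and |∂ₓρ_ε|, |∂_yρ_ε| ≤ M/ε^{3α}; (w₀ε) are continuous, 2π-periodic in each variable, with ∫_{−π}^{π}∫_{−π}^{π}|w₀ε| ≤ C₀; and w_ε is a continuously differentiable curve in C_b(ℝ²), 2π-periodic in each space variable, with w_ε(·,·,0) = w₀ε and ∂ₜw_ε(x,y,t) = (1/ε)[(w_ε u_ε⁺)(x−ε,y,t) − (w_ε|u_ε|)(x,y,t) + (w_ε u_ε⁻)(x+ε,y,t) + (w_ε v_ε⁺)(x,y−ε,t) − (w_ε|v_ε|)(x,y,t) + (w_ε v_ε⁻)(x,y+ε,t)] − P'(ρ_ε(x,y,t))∂ₓρ_ε(x,y,t) − Q'(ρ_ε(x,y,t))∂_yρ_ε(x,y,t). Then there exist N ∈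 ℕ such that for every δ > 0 there is C > 0 with ∫_{−π}^{π}∫_{−π}^{π}|w_ε(x,y,t)|dxdy ≤ C/ε^{Nα} for all ε ∈ (0,1) and t ∈ [0,δ]. -/

import Mathlib

open MeasureTheory Set Real

/-- The iterated integral over the square `[-π, π]²`. -/
noncomputable def squareIntegral (f : ℝ × ℝ → ℝ) : ℝ :=
  ∫ x in (-π)..π, ∫ y in (-π)..π, f (x, y)

theorem continuous_innerIntegral {f : ℝ × ℝ → ℝ} (hf : Continuous f) :
    Continuous fun x => ∫ y in (-π)..π, f (x, y) :=
  intervalIntegral.continuous_parametric_intervalIntegral_of_continuous'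
    (f := fun x y => f (x, y)) (by simpa [Function.uncurry_def] using hf) _ _

theorem squareIntegral_add {f g : ℝ × ℝ → ℝ} (hf : Continuous f) (hg : Continuous g) :
    squareIntegral (fun p => f p + g p) = squareIntegral f + squareIntegral g := by
  unfold squareIntegral
  rw [← intervalIntegral.integral_add ((continuous_innerIntegral hf).intervalIntegrable _ _)
    ((continuous_innerIntegral hg).intervalIntegrable _ _)]
  refine intervalIntegral.integral_congr fun x _ => ?_
  exact intervalIntegral.integral_add ((by fun_prop : Continuous _).intervalIntegrable _ _)
    ((by fun_prop : Continuous _).intervalIntegrable _ _)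

theorem squareIntegral_const_mul (c : ℝ) (f : ℝ × ℝ → ℝ) :
    squareIntegral (fun p => c * f p) = c * squareIntegral f := by
  simp [squareIntegral]

theorem squareIntegral_const (c : ℝ) : squareIntegral (fun _ => c) = 4 * π ^ 2 * c := by
  simp [squareIntegral]; ring

theorem squareIntegral_mono {f g : ℝ × ℝ → ℝ} (hf : Continuous f) (hg : Continuous g)
    (h : ∀ p, f p ≤ g p) : squareIntegral f ≤ squareIntegral g := by
  have hπ : -π ≤ π := by linarith [pi_pos]
  refine intervalIntegral.integral_mono hπ ((continuous_innerIntegral hf).intervalIntegrable _ _)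
    ((continuous_innerIntegral hg).intervalIntegrable _ _) fun x => ?_
  exact intervalIntegral.integral_mono hπ ((by fun_prop : Continuous _).intervalIntegrable _ _)
    ((by fun_prop : Continuous _).intervalIntegrable _ _) fun y => h _

theorem integral_comp_add_of_periodic {g : ℝ → ℝ} (hg : Function.Periodic g (2 * π)) (a : ℝ) :
    ∫ x in (-π)..π, g (x + a) = ∫ x in (-π)..π, g x := by
  rw [intervalIntegral.integral_comp_add_right]
  have := hg.intervalIntegral_add_eq (-π + a) (-π)
  rwa [show -π + a + 2 * π = π + a by ring, show -π + 2 * π = π by ring] at this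

theorem squareIntegral_comp_add_fst {f : ℝ × ℝ → ℝ}
    (hf : ∀ x y, f (x + 2 * π, y) = f (x, y)) (a : ℝ) :
    squareIntegral (fun p => f (p.1 + a, p.2)) = squareIntegral f :=
  integral_comp_add_of_periodic (g := fun x => ∫ y in (-π)..π, f (x, y))
    (fun x => by simp only [hf]) a

theorem squareIntegral_comp_add_snd {f : ℝ × ℝ → ℝ}
    (hf : ∀ x y, f (x, y + 2 * π) = f (x, y)) (a : ℝ) :
    squareIntegral (fun p => f (p.1, p.2 + a)) = squareIntegral f :=
  intervalIntegral.integral_congr fun x _ =>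
    integral_comp_add_of_periodic (g := fun y => f (x, y)) (fun y => hf x y) a

theorem squareIntegral_abs_le_add (f g : BoundedContinuousFunction (ℝ × ℝ) ℝ) :
    squareIntegral (fun p => |f p|) ≤ squareIntegral (fun p => |g p|) + 4 * π ^ 2 * ‖f - g‖ := by
  rw [← squareIntegral_const, ← squareIntegral_add (by fun_prop) (by fun_prop)]
  refine squareIntegral_mono (by fun_prop) (by fun_prop) fun p => ?_
  have h := (f - g).norm_coe_le_norm p
  rw [BoundedContinuousFunction.coe_sub, Pi.sub_apply, Real.norm_eq_abs] at h
  linarith [abs_sub_abs_le_abs_sub (f p) (g p)]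

theorem continuous_squareIntegral_abs :
    Continuous fun f : BoundedContinuousFunction (ℝ × ℝ) ℝ => squareIntegral fun p => |f p| := by
  refine LipschitzWith.continuous (K := (4 * π ^ 2).toNNReal) (LipschitzWith.of_le_add_mul _ ?_)
  intro f g
  rw [Real.coe_toNNReal _ (by positivity), dist_eq_norm]
  exact squareIntegral_abs_le_add f g

/-- Under the CFL condition `r * (|a| + |b|) ≤ 1`, an explicit upwind step does not increase
absolute values beyond the transported ones and the source. -/
theorem abs_upwind_le {w₀ w₁ w₂ w₃ w₄ a b a₁ a₂ b₃ b₄ d r B : ℝ} (hr : 0 ≤ r)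
    (hd : 0 ≤ d) (hab : r * (|a| + |b|) ≤ 1) (ha₁ : 0 ≤ a₁) (ha₂ : 0 ≤ a₂) (hb₃ : 0 ≤ b₃)
    (hb₄ : 0 ≤ b₄) {s : ℝ} (hs : |s| ≤ B) :
    |w₀ + (r * (w₁ * a₁ - w₀ * |a| + w₂ * a₂ + w₃ * b₃ - w₀ * |b| + w₄ * b₄) + d * s)| ≤
      |w₀| + r * (|w₁| * a₁ + |w₂| * a₂ + |w₃| * b₃ + |w₄| * b₄ - |w₀| * |a| - |w₀| * |b|)
        + d * B := by
  have h₀ : 0 ≤ 1 - r * (|a| + |b|) := by linarith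
  have e : w₀ + (r * (w₁ * a₁ - w₀ * |a| + w₂ * a₂ + w₃ * b₃ - w₀ * |b| + w₄ * b₄) + d * s)
      = w₀ * (1 - r * (|a| + |b|)) + w₁ * (r * a₁) + w₂ * (r * a₂) + w₃ * (r * b₃)
        + w₄ * (r * b₄) + d * s := by ring
  rw [e]
  have t : ∀ x c : ℝ, 0 ≤ c → |x * c| = |x| * c := fun x c hc => by rw [abs_mul, abs_of_nonneg hc]
  calc _ ≤ |w₀ * (1 - r * (|a| + |b|))| + |w₁ * (r * a₁)| + |w₂ * (r * a₂)| + |w₃ * (r * b₃)|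
        + |w₄ * (r * b₄)| + |d * s| := by
        refine (abs_add_le _ _).trans (add_le_add_left ?_ _)
        refine (abs_add_le _ _).trans (add_le_add_left ?_ _)
        refine (abs_add_le _ _).trans (add_le_add_left ?_ _)
        refine (abs_add_le _ _).trans (add_le_add_left ?_ _)
        exact abs_add_le _ _
    _ ≤ _ := by
        rw [t _ _ h₀, t _ _ (by positivity), t _ _ (by positivity), t _ _ (by positivity),
          t _ _ (by positivity), abs_mul d, abs_of_nonneg hd]
        have := mul_le_mul_of_nonneg_left hs hd
        linarith

/-- One explicit Euler step of the upwind scheme increases the `L¹` norm at most by the integral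
of the source term. -/
theorem squareIntegral_abs_euler_step_le {f g : BoundedContinuousFunction (ℝ × ℝ) ℝ}
    {a b s : ℝ × ℝ → ℝ} (ha : Continuous a) (hb : Continuous b)
    (hfx : ∀ x y, f (x + 2 * π, y) = f (x, y)) (hfy : ∀ x y, f (x, y + 2 * π) = f (x, y))
    (hax : ∀ x y, a (x + 2 * π, y) = a (x, y)) (hby : ∀ x y, b (x, y + 2 * π) = b (x, y))
    {ε d B : ℝ} (hε : 0 < ε) (hd : 0 ≤ d) (hab : ∀ p, d * (|a p| + |b p|) ≤ ε)
    (hs : ∀ p, |s p| ≤ B)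
    (hg : ∀ x y, g (x, y) = ε⁻¹ * (f (x - ε, y) * max (a (x - ε, y)) 0
          - f (x, y) * |a (x, y)| + f (x + ε, y) * max (-(a (x + ε, y))) 0
          + f (x, y - ε) * max (b (x, y - ε)) 0
          - f (x, y) * |b (x, y)| + f (x, y + ε) * max (-(b (x, y + ε))) 0) + s (x, y)) :
    squareIntegral (fun p => |(f + d • g) p|) ≤
      squareIntegral (fun p => |f p|) + d * (4 * π ^ 2 * B) := by
  let F₁ : ℝ × ℝ → ℝ := fun p => |f p| * max (a p) 0
  let F₂ : ℝ × ℝ → ℝ := fun p => |f p| * max (-(a p)) 0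
  let F₃ : ℝ × ℝ → ℝ := fun p => |f p| * max (b p) 0
  let F₄ : ℝ × ℝ → ℝ := fun p => |f p| * max (-(b p)) 0
  have c₁ : Continuous F₁ := by fun_prop
  have c₂ : Continuous F₂ := by fun_prop
  have c₃ : Continuous F₃ := by fun_prop
  have c₄ : Continuous F₄ := by fun_prop
  let D : ℝ × ℝ → ℝ := fun p => F₁ (p.1 + -ε, p.2) + F₂ (p.1 + ε, p.2) + F₃ (p.1, p.2 + -ε)
    + F₄ (p.1, p.2 + ε) + (-1) * (F₁ p + F₂ p + F₃ p + F₄ p)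
  have cD : Continuous D := by fun_prop
  have iD : squareIntegral D = 0 := by
    simp only [D]
    rw [squareIntegral_add (by fun_prop) (by fun_prop),
      squareIntegral_add (by fun_prop) (by fun_prop),
      squareIntegral_add (by fun_prop) (by fun_prop),
      squareIntegral_add (by fun_prop) (by fun_prop), squareIntegral_const_mul,
      squareIntegral_add (by fun_prop) (by fun_prop),
      squareIntegral_add (by fun_prop) (by fun_prop),
      squareIntegral_add (by fun_prop) (by fun_prop),
      squareIntegral_comp_add_fst (f := F₁) (fun x y => by simp only [F₁, hfx, hax]),
      squareIntegral_comp_add_fst (f := F₂) (fun x y => by simp only [F₂, hfx, hax]),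
      squareIntegral_comp_add_snd (f := F₃) (fun x y => by simp only [F₃, hfy, hby]),
      squareIntegral_comp_add_snd (f := F₄) (fun x y => by simp only [F₄, hfy, hby])]
    ring
  calc _ ≤ squareIntegral (fun p => |f p| + d * ε⁻¹ * D p + d * B) := by
        refine squareIntegral_mono (by fun_prop) (by fun_prop) ?_
        rintro ⟨x, y⟩
        have habs : ∀ r : ℝ, |r| = max r 0 + max (-r) 0 := fun r => by
          rcases le_total 0 r with h | h
          · rw [abs_of_nonneg h, max_eq_left h, max_eq_right (by linarith), add_zero]
          · rw [abs_of_nonpos h, max_eq_right h, max_eq_left (by linarith), zero_add]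
        have h := abs_upwind_le (w₀ := f (x, y)) (w₁ := f (x - ε, y)) (w₂ := f (x + ε, y))
          (w₃ := f (x, y - ε)) (w₄ := f (x, y + ε)) (r := d * ε⁻¹) (d := d)
          (a := a (x, y)) (b := b (x, y)) (by positivity) hd
          (by rw [mul_right_comm, ← div_eq_mul_inv, div_le_one hε]; exact hab _)
          (le_max_right (a (x - ε, y)) 0) (le_max_right (-(a (x + ε, y))) 0)
          (le_max_right (b (x, y - ε)) 0) (le_max_right (-(b (x, y + ε))) 0) (hs (x, y))
        have e₁ : (f + d • g) (x, y) = f (x, y) + d * g (x, y) := rfl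
        rw [e₁, hg]
        refine le_trans (le_of_eq ?_) (h.trans (le_of_eq ?_))
        · congr 1; ring
        · simp only [D, F₁, F₂, F₃, F₄, ← sub_eq_add_neg]
          rw [habs (a (x, y)), habs (b (x, y))]
          ring
    _ = _ := by
        rw [squareIntegral_add (by fun_prop) (by fun_prop),
          squareIntegral_add (by fun_prop) (by fun_prop), squareIntegral_const_mul, iD,
          squareIntegral_const]
        ring

/-- A curve of functions whose explicit Euler steps increase the `L¹` norm at rate at most `K`
has `L¹` norm growing at most linearly with slope `K`. -/
theorem squareIntegral_abs_le_of_euler_step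
    {w w' : ℝ → BoundedContinuousFunction (ℝ × ℝ) ℝ} {K d₀ : ℝ} (hd₀ : 0 < d₀)
    (hw : ∀ t ∈ Ici (0 : ℝ), HasDerivWithinAt w (w' t) (Ici 0) t)
    (hstep : ∀ t ∈ Ici (0 : ℝ), ∀ d ∈ Icc 0 d₀, squareIntegral (fun p => |(w t + d • w' t) p|) ≤
      squareIntegral (fun p => |w t p|) + d * K) {t : ℝ} (ht : 0 ≤ t) :
    squareIntegral (fun p => |w t p|) ≤ squareIntegral (fun p => |w 0 p|) + K * t := by
  have hB : ∀ x, HasDerivAt (fun t => squareIntegral (fun p => |w 0 p|) + K * t) K x := fun x => by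
    simpa using ((hasDerivAt_id x).const_mul K).const_add (squareIntegral (fun p => |w 0 p|))
  refine image_le_of_liminf_slope_right_le_deriv_boundary (a := 0) (b := t)
    (f := fun t => squareIntegral (fun p => |w t p|)) ?_ (by simp)
    (fun x _ => (hB x).continuousAt.continuousWithinAt) (fun x _ => (hB x).hasDerivWithinAt) ?_
    ⟨ht, le_rfl⟩
  · exact continuous_squareIntegral_abs.comp_continuousOn
      fun x hx => ((hw x hx.1).continuousWithinAt).mono Icc_subset_Ici_self
  · intro x hx r hr
    refine Filter.Eventually.frequently ?_
    have hc : 0 < (r - K) / (8 * π ^ 2) := div_pos (by linarith) (by positivity)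
    have h₁ := ((hw x hx.1).mono (Ioi_subset_Ici hx.1)).isLittleO.def hc
    have h₂ : Ioo x (x + d₀) ∈ nhdsWithin x (Ioi x) := Ioo_mem_nhdsGT (by linarith)
    filter_upwards [h₁, h₂] with z hz hz'
    have hzx : 0 < z - x := sub_pos.2 hz'.1
    have h₃ := squareIntegral_abs_le_add (w z) (w x + (z - x) • w' x)
    have h₄ := hstep x hx.1 (z - x) ⟨hzx.le, by linarith [hz'.2]⟩
    rw [Real.norm_eq_abs, abs_of_pos hzx, ← sub_add_eq_sub_sub] at hz
    rw [slope_def_field, div_lt_iff₀ hzx]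
    have h₅ : 4 * π ^ 2 * ‖w z - (w x + (z - x) • w' x)‖ ≤ (r - K) / 2 * (z - x) := by
      calc _ ≤ 4 * π ^ 2 * ((r - K) / (8 * π ^ 2) * (z - x)) := by gcongr
        _ = _ := by field_simp; ring
    nlinarith [mul_pos (sub_pos.2 hr) hzx]

theorem Polynomial.exists_abs_eval_le (p : Polynomial ℝ) :
    ∃ K, 0 ≤ K ∧ ∀ R x : ℝ, 1 ≤ R → |x| ≤ R → ∀ n, p.natDegree ≤ n → |p.eval x| ≤ K * R ^ n := by
  refine ⟨∑ i ∈ Finset.range (p.natDegree + 1), |p.coeff i|,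
    Finset.sum_nonneg fun _ _ => abs_nonneg _, fun R x hR hx n hn => ?_⟩
  rw [p.eval_eq_sum_range, Finset.sum_mul]
  refine (Finset.abs_sum_le_sum_abs _ _).trans (Finset.sum_le_sum fun i hi => ?_)
  rw [abs_mul, abs_pow]
  refine mul_le_mul_of_nonneg_left ?_ (abs_nonneg _)
  calc |x| ^ i ≤ R ^ i := by gcongr
    _ ≤ R ^ n := pow_le_pow_right₀ hR (by have := Finset.mem_range.1 hi; lia)

/-- Lemma 5: an a priori `L¹` bound `∫∫|w_ε| ≤ C/ε^{Nα}` for the solution `w_ε` of the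
2-D discrete transport ODE with source `−P'(ρ_ε)∂ₓρ_ε − Q'(ρ_ε)∂_yρ_ε`. -/
theorem stmt12 (P Q : Polynomial ℝ) (α : ℝ) (hα : α ∈ Ioc (0:ℝ) 1)
    (M₁ M C₀ : ℝ) (hM₁ : 0 < M₁) (hM : 0 < M) (hC₀ : 0 < C₀)
    (u v : ℝ → ℝ → ℝ → ℝ → ℝ) -- `u ε x y t`
    (hu_cont : ∀ ε ∈ Ioo (0:ℝ) 1, ContinuousOn
      (fun p : (ℝ × ℝ) × ℝ => u ε p.1.1 p.1.2 p.2) (univ ×ˢ Ici 0))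
    (hv_cont : ∀ ε ∈ Ioo (0:ℝ) 1, ContinuousOn
      (fun p : (ℝ × ℝ) × ℝ => v ε p.1.1 p.1.2 p.2) (univ ×ˢ Ici 0))
    (hu_per : ∀ ε ∈ Ioo (0:ℝ) 1, ∀ x y : ℝ, ∀ t ∈ Ici (0:ℝ),
      u ε (x + 2*π) y t = u ε x y t ∧ u ε x (y + 2*π) t = u ε x y t)
    (hv_per : ∀ ε ∈ Ioo (0:ℝ) 1, ∀ x y : ℝ, ∀ t ∈ Ici (0:ℝ),
      v ε (x + 2*π) y t = v ε x y t ∧ v ε x (y + 2*π) t = v ε x y t)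
    (hu_bdd : ∀ ε ∈ Ioo (0:ℝ) 1, ∀ x y : ℝ, ∀ t ∈ Ici (0:ℝ), |u ε x y t| ≤ M₁)
    (hv_bdd : ∀ ε ∈ Ioo (0:ℝ) 1, ∀ x y : ℝ, ∀ t ∈ Ici (0:ℝ), |v ε x y t| ≤ M₁)
    (ρ ρx ρy : ℝ → ℝ → ℝ → ℝ → ℝ) -- `ρ ε x y t` and its space partial derivatives
    (hρ_per : ∀ ε ∈ Ioo (0:ℝ) 1, ∀ x y : ℝ, ∀ t ∈ Ici (0:ℝ),
      ρ ε (x + 2*π) y t = ρ ε x y t ∧ ρ ε x (y + 2*π) t = ρ ε x y t)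
    (hρx : ∀ ε ∈ Ioo (0:ℝ) 1, ∀ x y : ℝ, ∀ t ∈ Ici (0:ℝ),
      HasDerivAt (fun z => ρ ε z y t) (ρx ε x y t) x)
    (hρy : ∀ ε ∈ Ioo (0:ℝ) 1, ∀ x y : ℝ, ∀ t ∈ Ici (0:ℝ),
      HasDerivAt (fun z => ρ ε x z t) (ρy ε x y t) y)
    (hρx_cont : ∀ ε ∈ Ioo (0:ℝ) 1, ∀ t ∈ Ici (0:ℝ),
      Continuous fun p : ℝ × ℝ => ρx ε p.1 p.2 t)
    (hρy_cont : ∀ ε ∈ Ioo (0:ℝ) 1, ∀ t ∈ Ici (0:ℝ),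
      Continuous fun p : ℝ × ℝ => ρy ε p.1 p.2 t)
    (hρ_bdd : ∀ ε ∈ Ioo (0:ℝ) 1, ∀ x y : ℝ, ∀ t ∈ Ici (0:ℝ),
      |ρ ε x y t| ≤ M / ε ^ (2 * α))
    (hρx_bdd : ∀ ε ∈ Ioo (0:ℝ) 1, ∀ x y : ℝ, ∀ t ∈ Ici (0:ℝ),
      |ρx ε x y t| ≤ M / ε ^ (3 * α))
    (hρy_bdd : ∀ ε ∈ Ioo (0:ℝ) 1, ∀ x y : ℝ, ∀ t ∈ Ici (0:ℝ),
      |ρy ε x y t| ≤ M / ε ^ (3 * α))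
    (w₀ : ℝ → ℝ → ℝ → ℝ) -- `w₀ ε x y`
    (hw₀c : ∀ ε ∈ Ioo (0:ℝ) 1, Continuous fun p : ℝ × ℝ => w₀ ε p.1 p.2)
    (hw₀p : ∀ ε ∈ Ioo (0:ℝ) 1, ∀ x y : ℝ,
      w₀ ε (x + 2*π) y = w₀ ε x y ∧ w₀ ε x (y + 2*π) = w₀ ε x y)
    (hw₀i : ∀ ε ∈ Ioo (0:ℝ) 1, (∫ x in (-π)..π, ∫ y in (-π)..π, |w₀ ε x y|) ≤ C₀)
    (w : ℝ → ℝ → BoundedContinuousFunction (ℝ × ℝ) ℝ) -- `w ε t`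
    (hw0 : ∀ ε ∈ Ioo (0:ℝ) 1, ∀ x y : ℝ, w ε 0 (x, y) = w₀ ε x y)
    (hwper : ∀ ε ∈ Ioo (0:ℝ) 1, ∀ t ∈ Ici (0:ℝ), ∀ x y : ℝ,
      w ε t (x + 2*π, y) = w ε t (x, y) ∧ w ε t (x, y + 2*π) = w ε t (x, y))
    (hw : ∀ ε ∈ Ioo (0:ℝ) 1, ∃ w' : ℝ → BoundedContinuousFunction (ℝ × ℝ) ℝ,
      ContinuousOn w' (Ici 0) ∧
      (∀ t ∈ Ici (0:ℝ), HasDerivWithinAt (w ε) (w' t) (Ici 0) t) ∧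
      (∀ t ∈ Ici (0:ℝ), ∀ x y : ℝ,
        w' t (x, y) = ε⁻¹ * (w ε t (x - ε, y) * max (u ε (x - ε) y t) 0
          - w ε t (x, y) * |u ε x y t| + w ε t (x + ε, y) * max (-(u ε (x + ε) y t)) 0
          + w ε t (x, y - ε) * max (v ε x (y - ε) t) 0
          - w ε t (x, y) * |v ε x y t| + w ε t (x, y + ε) * max (-(v ε x (y + ε) t)) 0)
          - P.derivative.eval (ρ ε x y t) * ρx ε x y t
          - Q.derivative.eval (ρ ε x y t) * ρy ε x y t)) :
    ∃ N : ℕ, ∀ δ > (0:ℝ), ∃ C > (0:ℝ), ∀ ε ∈ Ioo (0:ℝ) 1, ∀ t ∈ Icc (0:ℝ) δ,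
      (∫ x in (-π)..π, ∫ y in (-π)..π, |w ε t (x, y)|) ≤ C / ε ^ ((N : ℝ) * α) := by
  obtain ⟨KP, hKP, hP⟩ := P.derivative.exists_abs_eval_le
  obtain ⟨KQ, hKQ, hQ⟩ := Q.derivative.exists_abs_eval_le
  let n := P.derivative.natDegree + Q.derivative.natDegree
  let B₀ := (KP + KQ) * (M + 1) ^ n * M
  have hB₀ : 0 ≤ B₀ := by positivity
  refine ⟨2 * n + 3, fun δ hδ => ⟨C₀ + 4 * π ^ 2 * B₀ * δ, by positivity, fun ε hε t ht => ?_⟩⟩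
  have hε0 : 0 < ε := hε.1
  have hpow : ∀ r : ℝ, 0 ≤ r → ε ^ r ≤ 1 := fun r hr => Real.rpow_le_one hε0.le hε.2.le hr
  set E := ε ^ (((2 * n + 3 : ℕ) : ℝ) * α) with hE
  have hEpos : 0 < E := rpow_pos_of_pos hε0 _
  have hE1 : E ≤ 1 := hpow _ (mul_nonneg (Nat.cast_nonneg _) hα.1.le)
  have hEeq : E = (ε ^ (2 * α)) ^ n * ε ^ (3 * α) := by
    rw [hE, ← rpow_natCast, ← rpow_mul hε0.le, ← rpow_add hε0]
    congr 1; push_cast; ring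
  obtain ⟨w', -, hw', hode⟩ := hw ε hε
  have hsrc : ∀ t ∈ Ici (0 : ℝ), ∀ x y, |-(P.derivative.eval (ρ ε x y t) * ρx ε x y t)
      - Q.derivative.eval (ρ ε x y t) * ρy ε x y t| ≤ B₀ / E := by
    intro t ht x y
    have h2 : 0 < ε ^ (2 * α) := rpow_pos_of_pos hε0 _
    have h3 : 0 < ε ^ (3 * α) := rpow_pos_of_pos hε0 _
    have hR : 1 ≤ (M + 1) / ε ^ (2 * α) := by
      rw [le_div_iff₀ h2]
      linarith [hpow (2 * α) (by linarith [hα.1])]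
    have hρR : |ρ ε x y t| ≤ (M + 1) / ε ^ (2 * α) :=
      (hρ_bdd ε hε x y t ht).trans (by gcongr; linarith)
    calc _ ≤ |P.derivative.eval (ρ ε x y t)| * |ρx ε x y t|
          + |Q.derivative.eval (ρ ε x y t)| * |ρy ε x y t| := by
          rw [← abs_mul, ← abs_mul, ← abs_neg (P.derivative.eval (ρ ε x y t) * ρx ε x y t)]
          exact abs_sub _ _
      _ ≤ KP * ((M + 1) / ε ^ (2 * α)) ^ n * (M / ε ^ (3 * α))
          + KQ * ((M + 1) / ε ^ (2 * α)) ^ n * (M / ε ^ (3 * α)) := by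
          gcongr
          · exact hP _ _ hR hρR n (Nat.le_add_right _ _)
          · exact hρx_bdd ε hε x y t ht
          · exact hQ _ _ hR hρR n (Nat.le_add_left _ _)
          · exact hρy_bdd ε hε x y t ht
      _ = _ := by
          rw [hEeq, div_pow]
          simp only [B₀]
          field_simp
  have hslice : ∀ {f : ℝ → ℝ → ℝ → ℝ}, ContinuousOn
      (fun p : (ℝ × ℝ) × ℝ => f p.1.1 p.1.2 p.2) (univ ×ˢ Ici 0) → ∀ t ∈ Ici (0 : ℝ),
      Continuous fun p : ℝ × ℝ => f p.1 p.2 t := fun hf t ht =>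
    hf.comp_continuous (f := fun p : ℝ × ℝ => (p, t)) (by fun_prop) fun p => ⟨mem_univ _, ht⟩
  have key := squareIntegral_abs_le_of_euler_step (K := 4 * π ^ 2 * (B₀ / E))
    (d₀ := ε / (2 * M₁)) (by positivity) hw' (fun t ht d hd => by
      refine squareIntegral_abs_euler_step_le (a := fun p => u ε p.1 p.2 t)
        (b := fun p => v ε p.1 p.2 t)
        (s := fun p => -(P.derivative.eval (ρ ε p.1 p.2 t) * ρx ε p.1 p.2 t)
          - Q.derivative.eval (ρ ε p.1 p.2 t) * ρy ε p.1 p.2 t)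
        (hslice (hu_cont ε hε) t ht) (hslice (hv_cont ε hε) t ht)
        (fun x y => (hwper ε hε t ht x y).1) (fun x y => (hwper ε hε t ht x y).2)
        (fun x y => (hu_per ε hε x y t ht).1) (fun x y => (hv_per ε hε x y t ht).2)
        hε0 hd.1 (fun p => ?_) (fun p => hsrc t ht p.1 p.2) (fun x y => ?_)
      · calc d * (|u ε p.1 p.2 t| + |v ε p.1 p.2 t|) ≤ ε / (2 * M₁) * (M₁ + M₁) := by
              gcongr
              · exact hd.2
              · exact hu_bdd ε hε _ _ t ht
              · exact hv_bdd ε hε _ _ t ht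
          _ = ε := by field_simp; ring
      · rw [hode t ht x y]; ring) ht.1
  have h0 : squareIntegral (fun p => |w ε 0 p|) ≤ C₀ := by
    simpa only [squareIntegral, hw0 ε hε] using hw₀i ε hε
  calc _ ≤ squareIntegral (fun p => |w ε 0 p|) + 4 * π ^ 2 * (B₀ / E) * t := key
    _ ≤ C₀ / E + 4 * π ^ 2 * (B₀ / E) * δ := by
        gcongr
        · exact h0.trans (le_div_self hC₀.le hEpos hE1)
        · exact ht.2
    _ = _ := by ring
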